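/- Let u(n) := max_{w ∈ S_n} Υ_w. Then 1/4 ≤ liminf_{n→∞} (log₂ u(n))/n² and limsup_{n→∞} (log₂ u(n))/n² ≤ 1/2. -/

import Mathlib

/-- The simple transposition `sᵢ = (i, i+1)` acting on `ℕ` (positions are 1-indexed,
so a permutation of `{1,…,n}` is modeled as a permutation of `ℕ` fixing `0` and all `i > n`). -/
def sT (i : ℕ) : Equiv.Perm ℕ := Equiv.swap i (i + 1)

/-- The number of inversions `ℓ(w)` of `w` on `{1,…,n}`. -/
def len (n : ℕ) (w : Equiv.Perm ℕ) : ℕ :=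
  ((Finset.Icc 1 n ×ˢ Finset.Icc 1 n).filter
    (fun p => p.1 < p.2 ∧ w p.2 < w p.1)).card

open scoped Classical in
/-- Macdonald's identity form of the principal specialization `𝔖_w(1,…,1)` of the
Schubert polynomial: `Υ_w = (1/ℓ!) ⬝ Σ_{(a₁,…,a_ℓ) ∈ R(w)} a₁ a₂ ⋯ a_ℓ`, where the sum is
over reduced words of `w`, i.e. tuples with `1 ≤ aᵢ ≤ n − 1` and `w = s_{a₁} ⋯ s_{a_ℓ}`. -/
noncomputable def Upsilon (n : ℕ) (w : Equiv.Perm ℕ) : ℚ :=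
  ((len n w).factorial : ℚ)⁻¹ *
    ∑ a ∈ Finset.univ.filter (fun a : Fin (len n w) → Fin n =>
        (∀ i, 1 ≤ (a i : ℕ)) ∧ (List.ofFn fun i => sT ((a i : ℕ))).prod = w),
      ∏ i, ((a i : ℕ) : ℚ)

/-- `S_n`: permutations of `{1,…,n}`, modeled as permutations of `ℕ`
fixing `0` and every `i > n`. -/
def SymmOn (n : ℕ) : Set (Equiv.Perm ℕ) :=
  {w | ∀ i : ℕ, i = 0 ∨ n < i → w i = i}

/-- `u(n) = max_{w ∈ Sₙ} Υ_w` (as a real number; the set is finite and nonempty,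
so the supremum is attained). -/
noncomputable def u (n : ℕ) : ℝ :=
  sSup ((fun w => ((Upsilon n w : ℚ) : ℝ)) '' SymmOn n)

section NilCoxeter

open Polynomial

variable {R : Type*} [Ring R]

/-- The product `(1 + t b₀)(1 + t b₁) ⋯ (1 + t b_{d-1})` in `R[t]`. -/
noncomputable def nilRow (b : ℕ → R) : ℕ → R[X]
  | 0 => 1
  | d + 1 => nilRow b d * (1 + X * C (b d))

/-- The staircase product of the polynomials `nilRow`. -/
noncomputable def nilStair (b : ℕ → R) : ℕ → R[X]
  | 0 => 1
  | d + 1 => nilRow b (d + 1) * nilStair b d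

/-- The element `∑_{i < d} (d - i) bᵢ`. -/
def nilWeight (b : ℕ → R) : ℕ → R
  | 0 => 0
  | d + 1 => nilWeight b d + ∑ i ∈ Finset.range (d + 1), b i

/-- The relations of the nilCoxeter algebra of type `A`. -/
structure NilCoxeterRel (b : ℕ → R) : Prop where
  sq (i : ℕ) : b i * b i = 0
  braid (i : ℕ) : b i * b (i + 1) * b i = b (i + 1) * b i * b (i + 1)
  comm (i j : ℕ) : i + 2 ≤ j → Commute (b i) (b j)

variable {b : ℕ → R}

lemma NilCoxeterRel.commute_nilRow (hb : NilCoxeterRel b) (d j : ℕ) (hj : d + 1 ≤ j) :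
    Commute (nilRow b d) (C (b j)) := by
  induction d with
  | zero => exact Commute.one_left _
  | succ d ih =>
    refine (ih (by omega)).mul_left ((Commute.one_left _).add_left ?_)
    refine (Polynomial.commute_X _).mul_left ?_
    simp only [Commute, SemiconjBy, ← C_mul, (hb.comm d j (by omega)).eq]

lemma NilCoxeterRel.commute_sum (hb : NilCoxeterRel b) (d j : ℕ) (hj : d + 1 ≤ j) :
    Commute (∑ i ∈ Finset.range d, b i) (b j) :=
  Commute.sum_left _ _ _ fun i hi => hb.comm i j (by have := Finset.mem_range.1 hi; omega)

lemma NilCoxeterRel.commute_nilWeight (hb : NilCoxeterRel b) (d j : ℕ) (hj : d + 1 ≤ j) :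
    Commute (nilWeight b d) (b j) := by
  induction d with
  | zero => exact Commute.zero_left _
  | succ d ih => exact (ih (by omega)).add_left (hb.commute_sum _ _ hj)

lemma commute_mul_one_add_of_braid {t h z x y : R} (ht : ∀ r, t * r = r * t)
    (hx : x * x = 0) (hy : y * y = 0) (hxy : y * x * y = x * y * x)
    (hhx : h * x = x * h) (hzx : z * x = x * z)
    (hc : Commute (z + y) (h * (1 + t * y))) :
    Commute (z + y + x) (h * (1 + t * y) * (1 + t * x)) := by
  have hz : (1 + t * x) * z = z * (1 + t * x) := by
    rw [add_mul, mul_add, mul_assoc, ← hzx, ← mul_assoc, ht z, mul_assoc]; simp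
  have key : y * (1 + t * x) + t * y * (y * (1 + t * x)) + x * (1 + t * y) * (1 + t * x) =
      (1 + t * y) * ((1 + t * x) * (y + x)) := by
    have hx' (q) : x * (x * q) = 0 := by rw [← mul_assoc, hx, zero_mul]
    have hy' (q) : y * (y * q) = 0 := by rw [← mul_assoc, hy, zero_mul]
    have t1 (q) : t * (x * q) = x * (t * q) := by rw [← mul_assoc, ht, mul_assoc]
    have t2 (q) : t * (y * q) = y * (t * q) := by rw [← mul_assoc, ht, mul_assoc]
    have hxy' (q) : y * (x * (y * q)) = x * (y * (x * q)) := by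
      simp only [← mul_assoc, hxy]
    simp only [mul_add, add_mul, mul_one, one_mul, mul_assoc, t1, t2, ht x, ht y, hx', hy', hxy',
      add_zero, zero_add]
    abel
  calc (z + y + x) * (h * (1 + t * y) * (1 + t * x))
      = ((z + y) * (h * (1 + t * y))) * (1 + t * x) + x * h * (1 + t * y) * (1 + t * x) := by
        noncomm_ring
    _ = h * ((1 + t * y) * (z * (1 + t * x)) +
          (y * (1 + t * x) + t * y * (y * (1 + t * x)) + x * (1 + t * y) * (1 + t * x))) := by
        rw [hc.eq, ← hhx]; noncomm_ring
    _ = h * (1 + t * y) * (1 + t * x) * (z + y + x) := by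
        rw [key, ← hz]; noncomm_ring

lemma NilCoxeterRel.sum_commute_nilRow (hb : NilCoxeterRel b) (d : ℕ) :
    Commute (C (∑ i ∈ Finset.range d, b i)) (nilRow b d) := by
  induction d with
  | zero => exact Commute.one_right _
  | succ d ih =>
    cases d with
    | zero =>
      rw [nilRow, nilRow, one_mul, Finset.sum_range_one]
      exact (Commute.one_right _).add_right
        ((Polynomial.commute_X _).symm.mul_right (Commute.refl _))
    | succ e =>
      rw [Finset.sum_range_succ, C_add] at ih ⊢
      rw [Finset.sum_range_succ, C_add]
      refine commute_mul_one_add_of_braid (fun r => (Polynomial.commute_X r).eq) ?_ ?_ ?_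
        (hb.commute_nilRow e (e + 1) le_rfl).eq ?_ ih
      · rw [← C_mul, hb.sq, C_0]
      · rw [← C_mul, hb.sq, C_0]
      · simp only [← C_mul, hb.braid]
      · simp only [← C_mul, (hb.commute_sum e (e + 1) le_rfl).eq]

lemma NilCoxeterRel.weight_mul_nilRow (hb : NilCoxeterRel b) (d : ℕ) :
    C (nilWeight b (d + 1)) * nilRow b (d + 1) =
      derivative (nilRow b (d + 1)) + nilRow b (d + 1) * C (nilWeight b d) := by
  induction d with
  | zero =>
    have : C (b 0) * (X * C (b 0)) = 0 := by
      rw [← mul_assoc, ← (Polynomial.commute_X (C (b 0))).eq, mul_assoc, ← C_mul, hb.sq]; simp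
    simp only [nilRow, nilWeight, mul_add, this, zero_add, Finset.sum_range_one, one_mul,
      mul_one, add_zero, C_0, mul_zero, derivative_add, derivative_one, derivative_mul,
      derivative_X, derivative_C]
  | succ d ih =>
    have hc := (hb.sum_commute_nilRow (d + 2)).eq
    have hx : C (b (d + 1)) * C (b (d + 1)) = 0 := by rw [← C_mul, hb.sq, C_0]
    have hw : (1 + X * C (b (d + 1))) * C (nilWeight b d) =
        C (nilWeight b d) * (1 + X * C (b (d + 1))) := by
      refine (((Commute.one_left _).add_left ((Polynomial.commute_X _).mul_left ?_))).eq
      simp only [Commute, SemiconjBy, ← C_mul, (hb.commute_nilWeight d (d + 1) le_rfl).eq]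
    have hxx : (1 + X * C (b (d + 1))) * C (b (d + 1)) = C (b (d + 1)) := by
      rw [add_mul, mul_assoc, hx]; simp
    have hD : derivative (nilRow b (d + 2)) =
        derivative (nilRow b (d + 1)) * (1 + X * C (b (d + 1))) +
          nilRow b (d + 1) * C (b (d + 1)) := by
      simp [nilRow, derivative_mul]
    have hr : nilRow b (d + 2) = nilRow b (d + 1) * (1 + X * C (b (d + 1))) := rfl
    calc C (nilWeight b (d + 2)) * nilRow b (d + 2)
        = (C (nilWeight b (d + 1)) * nilRow b (d + 1)) * (1 + X * C (b (d + 1))) +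
          C (∑ i ∈ Finset.range (d + 2), b i) * nilRow b (d + 2) := by
          rw [nilWeight, C_add, add_mul, hr, mul_assoc]
      _ = derivative (nilRow b (d + 1)) * (1 + X * C (b (d + 1))) +
          nilRow b (d + 1) * (C (nilWeight b d) * (1 + X * C (b (d + 1)))) +
          nilRow b (d + 2) * C (∑ i ∈ Finset.range (d + 2), b i) := by
          rw [ih, hc, add_mul, mul_assoc (nilRow b (d + 1))]
      _ = derivative (nilRow b (d + 1)) * (1 + X * C (b (d + 1))) +
          nilRow b (d + 1) * ((1 + X * C (b (d + 1))) * C (b (d + 1))) +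
          nilRow b (d + 2) * C (nilWeight b (d + 1)) := by
          rw [← hw, Finset.sum_range_succ, nilWeight, C_add, C_add, hr]; noncomm_ring
      _ = _ := by rw [hxx, hD]

lemma NilCoxeterRel.derivative_nilStair (hb : NilCoxeterRel b) (d : ℕ) :
    derivative (nilStair b d) = C (nilWeight b d) * nilStair b d := by
  induction d with
  | zero => simp [nilStair, nilWeight]
  | succ d ih =>
    rw [nilStair, derivative_mul, ih, ← mul_assoc, ← mul_assoc, ← add_mul,
      hb.weight_mul_nilRow]

lemma coeff_zero_nilRow (d : ℕ) : (nilRow b d).coeff 0 = 1 := by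
  induction d with
  | zero => simp [nilRow]
  | succ d ih => rw [nilRow, mul_coeff_zero, ih]; simp

lemma NilCoxeterRel.factorial_nsmul_coeff_nilStair (hb : NilCoxeterRel b) (d k : ℕ) :
    k.factorial • (nilStair b d).coeff k = nilWeight b d ^ k := by
  induction k with
  | zero =>
    simp only [Nat.factorial_zero, one_smul, pow_zero]
    induction d with
    | zero => simp [nilStair]
    | succ d ih => rw [nilStair, mul_coeff_zero, ih, coeff_zero_nilRow, one_mul]
  | succ k ih =>
    have h := congrArg (fun p => coeff p k) (hb.derivative_nilStair d)
    simp only [coeff_derivative, coeff_C_mul] at h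
    rw [pow_succ', ← ih, mul_smul_comm, ← h, Nat.factorial_succ, mul_comm, mul_smul,
      nsmul_eq_mul (k + 1), Nat.cast_comm, Nat.cast_succ]

lemma nilWeight_eq_sum (d : ℕ) :
    nilWeight b d = ∑ i ∈ Finset.range d, (d - i) • b i := by
  induction d with
  | zero => simp [nilWeight]
  | succ d ih =>
    rw [nilWeight, ih, Finset.sum_range_succ, Finset.sum_range_succ, ← add_assoc,
      ← Finset.sum_add_distrib]
    congr 1
    · refine Finset.sum_congr rfl fun i hi => ?_
      rw [Nat.succ_sub (Finset.mem_range.1 hi).le, succ_nsmul]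
    · simp

lemma natDegree_nilRow_le (d : ℕ) : (nilRow b d).natDegree ≤ d := by
  induction d with
  | zero => simp [nilRow]
  | succ d ih =>
    refine natDegree_mul_le_of_le ih ?_
    refine natDegree_add_le_of_degree_le (by simp) ?_
    refine (natDegree_mul_le_of_le natDegree_X_le (natDegree_C _).le).trans (by simp)

lemma coeff_nilRow_succ (d : ℕ) :
    (nilRow b (d + 1)).coeff (d + 1) = (nilRow b d).coeff d * b d := by
  rw [nilRow, coeff_mul_add_eq_of_natDegree_le (natDegree_nilRow_le d)]
  · simp [coeff_one]
  · refine natDegree_add_le_of_degree_le (by simp) ?_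
    refine (natDegree_mul_le_of_le natDegree_X_le (natDegree_C _).le).trans (by simp)

lemma natDegree_nilStair_le (d : ℕ) :
    (nilStair b d).natDegree ≤ ∑ i ∈ Finset.range (d + 1), i := by
  induction d with
  | zero => simp [nilStair]
  | succ d ih =>
    rw [Finset.sum_range_succ, add_comm (∑ i ∈ _, i)]
    exact natDegree_mul_le_of_le (natDegree_nilRow_le _) ih

lemma coeff_nilStair_succ (d : ℕ) :
    (nilStair b (d + 1)).coeff (∑ i ∈ Finset.range (d + 2), i) =
      (nilRow b (d + 1)).coeff (d + 1) *
        (nilStair b d).coeff (∑ i ∈ Finset.range (d + 1), i) := by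
  rw [Finset.sum_range_succ, add_comm (∑ i ∈ _, i), nilStair,
    coeff_mul_add_eq_of_natDegree_le (natDegree_nilRow_le _) (natDegree_nilStair_le _)]

end NilCoxeter

lemma sT_mul_self (i : ℕ) : sT i * sT i = 1 := Equiv.swap_mul_self _ _

lemma mul_sT_mul_sT (w : Equiv.Perm ℕ) (i : ℕ) : w * sT i * sT i = w := by
  rw [mul_assoc, sT_mul_self, mul_one]

lemma sT_left (i : ℕ) : sT i i = i + 1 := Equiv.swap_apply_left _ _

lemma sT_right (i : ℕ) : sT i (i + 1) = i := Equiv.swap_apply_right _ _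

lemma sT_of_ne {i j : ℕ} (hi : j ≠ i) (hj : j ≠ i + 1) : sT i j = j :=
  Equiv.swap_apply_of_ne_of_ne hi hj

/-- The operator on functions on permutations induced by right multiplication by `sT i`
along length-increasing steps. -/
def stepOp (i : ℕ) : Module.End ℚ (Equiv.Perm ℕ → ℚ) where
  toFun g w := if w (i + 1) < w i then g (w * sT i) else 0
  map_add' f g := by ext w; by_cases h : w (i + 1) < w i <;> simp [h]
  map_smul' c f := by ext w; by_cases h : w (i + 1) < w i <;> simp [h]

lemma stepOp_apply (i : ℕ) (g : Equiv.Perm ℕ → ℚ) (w : Equiv.Perm ℕ) :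
    stepOp i g w = if w (i + 1) < w i then g (w * sT i) else 0 := rfl

lemma stepOp_sq (i : ℕ) : stepOp i * stepOp i = 0 := by
  ext g w
  simp only [Module.End.mul_apply, stepOp_apply, Equiv.Perm.mul_apply, sT_left, sT_right]
  split_ifs <;> first | rfl | lia

lemma sT_braid (i : ℕ) : sT i * sT (i + 1) * sT i = sT (i + 1) * sT i * sT (i + 1) := by
  ext j
  simp only [Equiv.Perm.mul_apply, sT, Equiv.swap_apply_def]
  split_ifs <;> omega

lemma sT_comm {i j : ℕ} (h : i + 2 ≤ j) : sT i * sT j = sT j * sT i := by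
  ext k
  simp only [Equiv.Perm.mul_apply, sT, Equiv.swap_apply_def]
  split_ifs <;> omega

lemma stepOp_braid (i : ℕ) :
    stepOp i * stepOp (i + 1) * stepOp i = stepOp (i + 1) * stepOp i * stepOp (i + 1) := by
  ext g w
  have h1 : sT i (i + 1 + 1) = i + 1 + 1 := sT_of_ne (by omega) (by omega)
  have h2 : sT (i + 1) i = i := sT_of_ne (by omega) (by omega)
  have h3 : w * sT i * sT (i + 1) * sT i = w * sT (i + 1) * sT i * sT (i + 1) := by
    have := sT_braid i
    simp only [mul_assoc] at this ⊢
    rw [this]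
  simp only [Module.End.mul_apply, stepOp_apply, Equiv.Perm.mul_apply, sT_left, sT_right, h1, h2,
    h3]
  split_ifs <;> rfl

lemma stepOp_comm {i j : ℕ} (h : i + 2 ≤ j) : Commute (stepOp i) (stepOp j) := by
  refine LinearMap.ext fun g => funext fun w => ?_
  have h1 : sT i j = j := sT_of_ne (by omega) (by omega)
  have h2 : sT i (j + 1) = j + 1 := sT_of_ne (by omega) (by omega)
  have h3 : sT j i = i := sT_of_ne (by omega) (by omega)
  have h4 : sT j (i + 1) = i + 1 := sT_of_ne (by omega) (by omega)
  have h5 : w * sT i * sT j = w * sT j * sT i := by rw [mul_assoc, sT_comm h, mul_assoc]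
  simp only [Module.End.mul_apply, stepOp_apply, Equiv.Perm.mul_apply, h1, h2, h3, h4, h5]
  split_ifs <;> rfl

open scoped Classical in
/-- The indicator function of a permutation. -/
noncomputable def permSingle (v w : Equiv.Perm ℕ) : ℚ := if w = v then 1 else 0

lemma permSingle_self (v : Equiv.Perm ℕ) : permSingle v v = 1 := if_pos rfl

lemma permSingle_of_ne {v w : Equiv.Perm ℕ} (h : w ≠ v) : permSingle v w = 0 := if_neg h

lemma stepOp_single {i : ℕ} {v : Equiv.Perm ℕ} (h : v i < v (i + 1)) :
    stepOp i (permSingle v) = permSingle (v * sT i) := by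
  ext w
  rw [stepOp_apply]
  by_cases hw : w = v * sT i
  · subst hw
    simp [sT_left, sT_right, h, mul_sT_mul_sT, permSingle_self]
  · have : w * sT i ≠ v := fun e => hw (by rw [← e, mul_sT_mul_sT])
    simp [permSingle_of_ne hw, permSingle_of_ne this]

/-- The operators `stepOp (n - 1), …, stepOp 1`, followed by zeros. -/
def revStep (n i : ℕ) : Module.End ℚ (Equiv.Perm ℕ → ℚ) :=
  if i + 1 < n then stepOp (n - 1 - i) else 0

lemma nilCoxeterRel_revStep (n : ℕ) : NilCoxeterRel (revStep n) where
  sq i := by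
    unfold revStep
    split_ifs <;> simp [stepOp_sq]
  braid i := by
    unfold revStep
    by_cases h : i + 1 + 1 < n
    · have := stepOp_braid (n - 1 - (i + 1))
      rw [show n - 1 - (i + 1) + 1 = n - 1 - i by omega] at this
      rw [if_pos h, if_pos (by omega), this]
    · simp [h]
  comm i j hij := by
    unfold revStep
    by_cases h : j + 1 < n
    · rw [if_pos h, if_pos (by omega)]
      exact (stepOp_comm (by omega)).symm
    · rw [if_neg h]
      exact Commute.zero_right _

lemma nilWeight_revStep (n : ℕ) :
    nilWeight (revStep n) (n - 1) = ∑ i ∈ Finset.range n, i • stepOp i := by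
  rw [nilWeight_eq_sum]
  cases n with
  | zero => simp
  | succ n =>
    rw [Finset.sum_range_succ', zero_smul, add_zero, ← Finset.sum_range_reflect]
    refine Finset.sum_congr (by simp) fun i hi => ?_
    have hi : i < n := by simpa using hi
    rw [revStep, if_pos (by omega)]
    congr 2 <;> omega

/-- The weighted sum `∑ a₁ ⋯ a_k` over words with `s_{a₁} ⋯ s_{a_k} = w`. -/
noncomputable def wordSum (n : ℕ) : ℕ → Equiv.Perm ℕ → ℚ
  | 0 => permSingle 1
  | k + 1 => fun w => ∑ i ∈ Finset.range n, (i : ℚ) * wordSum n k (w * sT i)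

lemma wordSum_succ (n k : ℕ) (w : Equiv.Perm ℕ) :
    wordSum n (k + 1) w = ∑ i ∈ Finset.range n, (i : ℚ) * wordSum n k (w * sT i) := rfl

open scoped Classical in
lemma sum_words_eq_wordSum (n k : ℕ) (w : Equiv.Perm ℕ) :
    ∑ a ∈ Finset.univ.filter (fun a : Fin k → Fin n =>
        (∀ i, 1 ≤ (a i : ℕ)) ∧ (List.ofFn fun i => sT ((a i : ℕ))).prod = w),
      ∏ i, ((a i : ℕ) : ℚ) = wordSum n k w := by
  have h0 : ∑ a ∈ Finset.univ.filter (fun a : Fin k → Fin n =>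
        (∀ i, 1 ≤ (a i : ℕ)) ∧ (List.ofFn fun i => sT ((a i : ℕ))).prod = w),
      ∏ i, ((a i : ℕ) : ℚ) = ∑ a : Fin k → Fin n,
        if (List.ofFn fun i => sT ((a i : ℕ))).prod = w then ∏ i, ((a i : ℕ) : ℚ) else 0 := by
    rw [Finset.sum_filter]
    refine Finset.sum_congr rfl fun a _ => ?_
    by_cases ha : ∀ i, 1 ≤ (a i : ℕ)
    · simp only [ha, implies_true, true_and]
    · rw [if_neg (fun h => ha h.1)]
      push Not at ha
      obtain ⟨i, hi⟩ := ha
      rw [Finset.prod_eq_zero (Finset.mem_univ i) (by simp; omega), ite_self]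
  rw [h0]
  clear h0
  induction k generalizing w with
  | zero => simp [wordSum, permSingle, eq_comm]
  | succ k ih =>
    rw [wordSum_succ, ← Fin.sum_univ_eq_sum_range (fun i => (i : ℚ) * wordSum n k (w * sT i)),
      ← (Fin.snocEquiv fun _ => Fin n).sum_comp, Fintype.sum_prod_type]
    refine Finset.sum_congr rfl fun i _ => ?_
    rw [← ih, Finset.mul_sum]
    refine Finset.sum_congr rfl fun a _ => ?_
    have h1 : ∀ p : Equiv.Perm ℕ, p * sT i = w ↔ p = w * sT i := fun p =>
      ⟨fun h => by rw [← h, mul_sT_mul_sT], fun h => by rw [h, mul_sT_mul_sT]⟩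
    simp only [Fin.snocEquiv_apply, List.ofFn_succ', List.prod_concat, Fin.snoc_castSucc,
      Fin.snoc_last, Fin.prod_univ_castSucc, h1, mul_ite, mul_zero]
    rw [mul_comm]

lemma Upsilon_eq (n : ℕ) (w : Equiv.Perm ℕ) :
    Upsilon n w = ((len n w).factorial : ℚ)⁻¹ * wordSum n (len n w) w := by
  rw [Upsilon, sum_words_eq_wordSum]

lemma wordSum_nonneg (n k : ℕ) (w : Equiv.Perm ℕ) : 0 ≤ wordSum n k w := by
  induction k generalizing w with
  | zero => rw [wordSum, permSingle]; split_ifs <;> norm_num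
  | succ k ih => exact Finset.sum_nonneg fun i _ => mul_nonneg (Nat.cast_nonneg i) (ih _)

lemma len_one (n : ℕ) : len n 1 = 0 := by
  rw [len, Finset.card_eq_zero, Finset.filter_eq_empty_iff]
  rintro p - ⟨h, h'⟩
  exact lt_asymm h h'

lemma len_mul_sT {n i : ℕ} (h1 : 1 ≤ i) (hn : i < n) {w : Equiv.Perm ℕ} (h : w i < w (i + 1)) :
    len n (w * sT i) = len n w + 1 := by
  classical
  have hs : ∀ j, j = i ∧ sT i j = i + 1 ∨ j = i + 1 ∧ sT i j = i ∨
      j ≠ i ∧ j ≠ i + 1 ∧ sT i j = j := by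
    intro j
    by_cases hj : j = i
    · subst hj; exact Or.inl ⟨rfl, sT_left _⟩
    by_cases hj' : j = i + 1
    · subst hj'; exact Or.inr (Or.inl ⟨rfl, sT_right _⟩)
    exact Or.inr (Or.inr ⟨hj, hj', sT_of_ne hj hj'⟩)
  have hss : ∀ j, sT i (sT i j) = j := fun j => by
    rw [← Equiv.Perm.mul_apply, sT_mul_self, Equiv.Perm.one_apply]
  have hnot : (i, i + 1) ∉ ((Finset.Icc 1 n ×ˢ Finset.Icc 1 n).filter
      (fun p : ℕ × ℕ => p.1 < p.2 ∧ w p.2 < w p.1)).map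
        ((sT i).prodCongr (sT i)).toEmbedding := by
    simp only [Finset.mem_map, Finset.mem_filter, not_exists, not_and]
    rintro ⟨a, b⟩ ⟨-, hab, -⟩ hE
    simp only [Equiv.coe_toEmbedding, Equiv.prodCongr_apply, Prod.map_apply, Prod.mk.injEq] at hE
    have ha := hs a
    have hb := hs b
    simp only at hab
    omega
  rw [len, len, ← Finset.card_map (s := Finset.filter (fun p : ℕ × ℕ => p.1 < p.2 ∧ w p.2 < w p.1) _)
    ((sT i).prodCongr (sT i)).toEmbedding, ← Finset.card_insert_of_notMem hnot]
  congr 1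
  ext ⟨a, b⟩
  have hw := hss a
  have hw' := hss b
  have ha := hs a
  have hb := hs b
  rw [Finset.mem_filter, Finset.mem_insert]
  simp only [Finset.mem_filter, Finset.mem_product, Finset.mem_Icc, Equiv.Perm.mul_apply,
    Finset.mem_map, Prod.mk.injEq, Prod.exists, Equiv.coe_toEmbedding,
    Equiv.prodCongr_apply, Prod.map_apply]
  constructor
  · rintro ⟨hr, hab, hlt⟩
    by_cases hc : a = i ∧ b = i + 1
    · exact Or.inl hc
    · refine Or.inr ⟨sT i a, sT i b, ⟨by omega, by omega, hlt⟩, hw, hw'⟩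
  · rintro (⟨rfl, rfl⟩ | ⟨c, d, ⟨hr, hcd, hlt⟩, rfl, rfl⟩)
    · rw [sT_left, sT_right]
      omega
    · rw [hss, hss]
      have hc := hs c
      have hd := hs d
      refine ⟨by omega, ?_, hlt⟩
      by_contra hcon
      have : c = i ∧ d = i + 1 := by omega
      obtain ⟨rfl, rfl⟩ := this
      omega

lemma len_eq_succ {n i : ℕ} (h1 : 1 ≤ i) (hn : i < n) {w : Equiv.Perm ℕ} (h : w (i + 1) < w i) :
    len n w = len n (w * sT i) + 1 := by
  have := len_mul_sT h1 hn (w := w * sT i) (by simpa [sT_left, sT_right] using h)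
  rwa [mul_sT_mul_sT] at this

lemma len_le_of_wordSum_ne_zero {n k : ℕ} {w : Equiv.Perm ℕ} (h : wordSum n k w ≠ 0) :
    len n w ≤ k ∧ w ∈ SymmOn n := by
  induction k generalizing w with
  | zero =>
    have : w = 1 := by
      by_contra hw
      exact h (by simp [wordSum, permSingle_of_ne hw])
    subst this
    exact ⟨(len_one n).le, fun i _ => rfl⟩
  | succ k ih =>
    obtain ⟨i, hi, hne⟩ := Finset.exists_ne_zero_of_sum_ne_zero h
    have hi' := Finset.mem_range.1 hi
    have h0 : i ≠ 0 := by rintro rfl; simp at hne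
    obtain ⟨hl, hS⟩ := ih (right_ne_zero_of_mul hne)
    constructor
    · rcases lt_or_gt_of_ne (fun e => by simpa using w.injective e : w i ≠ w (i + 1)) with h | h
      · have := len_mul_sT (by omega) hi' h
        omega
      · have := len_eq_succ (by omega) hi' h
        omega
    · intro j hj
      have := hS j hj
      rwa [Equiv.Perm.mul_apply, sT_of_ne (by omega) (by omega)] at this

lemma weightOp_pow_single (n k : ℕ) (w : Equiv.Perm ℕ) :
    ((∑ i ∈ Finset.range n, i • stepOp i) ^ k) (permSingle 1) w =
      if len n w = k then wordSum n k w else 0 := by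
  induction k generalizing w with
  | zero =>
    by_cases h : w = 1
    · subst h; simp [len_one, wordSum]
    · simp [wordSum, permSingle_of_ne h]
  | succ k ih =>
    rw [pow_succ', Module.End.mul_apply, LinearMap.sum_apply, Finset.sum_apply]
    have key : ∀ i ∈ Finset.range n,
        (i • stepOp i) (((∑ i ∈ Finset.range n, i • stepOp i) ^ k) (permSingle 1)) w =
          if len n w = k + 1 then (i : ℚ) * wordSum n k (w * sT i) else 0 := by
      intro i hi
      rw [LinearMap.smul_apply, Pi.smul_apply, stepOp_apply, ih, nsmul_eq_mul]
      rcases Nat.eq_zero_or_pos i with rfl | hpos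
      · simp
      rcases lt_or_gt_of_ne (fun e => by simpa using w.injective e : w i ≠ w (i + 1)) with h | h
      · have := len_mul_sT hpos (Finset.mem_range.1 hi) h
        rw [if_neg h.not_gt]
        split_ifs with hk
        · by_contra hne
          have := (len_le_of_wordSum_ne_zero (fun e => hne (by rw [e]) :
            wordSum n k (w * sT i) ≠ 0)).1
          omega
        · simp
      · have := len_eq_succ hpos (Finset.mem_range.1 hi) h
        rw [if_pos h, this]
        simp only [Nat.add_right_cancel_iff, mul_ite, mul_zero]
    rw [Finset.sum_congr rfl key]
    split_ifs
    · rfl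
    · simp

lemma factorial_mul_coeff_nilStair (n k : ℕ) (w : Equiv.Perm ℕ) :
    (k.factorial : ℚ) * (nilStair (revStep n) (n - 1)).coeff k (permSingle 1) w =
      if len n w = k then wordSum n k w else 0 := by
  rw [← weightOp_pow_single, ← nilWeight_revStep,
    ← (nilCoxeterRel_revStep n).factorial_nsmul_coeff_nilStair, LinearMap.smul_apply,
    Pi.smul_apply, nsmul_eq_mul]

lemma Upsilon_eq_coeff (n : ℕ) (w : Equiv.Perm ℕ) :
    Upsilon n w = (nilStair (revStep n) (n - 1)).coeff (len n w) (permSingle 1) w := by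
  have h := factorial_mul_coeff_nilStair n (len n w) w
  rw [if_pos rfl] at h
  rw [Upsilon_eq, ← h, inv_mul_cancel_left₀ (by positivity)]

lemma abs_revStep_le {n i : ℕ} {g : Equiv.Perm ℕ → ℚ} {B : ℚ} (hg : ∀ w, |g w| ≤ B)
    (w : Equiv.Perm ℕ) : |revStep n i g w| ≤ B := by
  have hB : 0 ≤ B := (abs_nonneg _).trans (hg 1)
  rw [revStep]
  split_ifs
  · rw [stepOp_apply]
    split_ifs
    · exact hg _
    · simpa using hB
  · simpa using hB

open Polynomial in
lemma abs_coeff_nilRow_mul_le (n d : ℕ) (e : Equiv.Perm ℕ → ℚ)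
    (Q : (Module.End ℚ (Equiv.Perm ℕ → ℚ))[X]) (B : ℚ) (hQ : ∀ k w, |Q.coeff k e w| ≤ B)
    (k : ℕ) (w : Equiv.Perm ℕ) :
    |(nilRow (revStep n) d * Q).coeff k e w| ≤ 2 ^ d * B := by
  have hB : 0 ≤ B := (abs_nonneg _).trans (hQ 0 1)
  induction d generalizing Q B k w with
  | zero => simpa [nilRow] using hQ k w
  | succ d ih =>
    rw [nilRow, mul_assoc, pow_succ, mul_assoc]
    refine ih _ _ (fun k w => ?_) _ _ (by positivity)
    rw [add_mul, one_mul, mul_assoc, coeff_add, LinearMap.add_apply, Pi.add_apply, two_mul]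
    refine (abs_add_le _ _).trans (add_le_add (hQ k w) ?_)
    cases k with
    | zero => simpa using hB
    | succ k =>
      rw [coeff_X_mul, coeff_C_mul, Module.End.mul_apply]
      exact abs_revStep_le (hQ k) w

lemma abs_coeff_nilStair_le (n d k : ℕ) (w : Equiv.Perm ℕ) :
    |(nilStair (revStep n) d).coeff k (permSingle 1) w| ≤
      2 ^ (∑ i ∈ Finset.range (d + 1), i) := by
  induction d generalizing k w with
  | zero =>
    cases k with
    | zero =>
      simp only [nilStair, Polynomial.coeff_one_zero, Module.End.one_apply, permSingle]
      split_ifs <;> simp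
    | succ k => simp [nilStair, Polynomial.coeff_one]
  | succ d ih =>
    rw [Finset.sum_range_succ, add_comm (∑ i ∈ _, i), pow_add, nilStair]
    exact abs_coeff_nilRow_mul_le _ _ _ _ _ ih _ _

lemma sum_range_pred_succ (n : ℕ) :
    ∑ i ∈ Finset.range (n - 1 + 1), i = ∑ i ∈ Finset.range n, i := by
  cases n <;> simp

lemma Upsilon_le (n : ℕ) (w : Equiv.Perm ℕ) :
    Upsilon n w ≤ 2 ^ (∑ i ∈ Finset.range n, i) := by
  rw [Upsilon_eq_coeff, ← sum_range_pred_succ]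
  exact (le_abs_self _).trans (abs_coeff_nilStair_le _ _ _ _)

lemma exists_coeff_nilRow_single (n m d : ℕ) (hd : d ≤ n - m) (hm : 1 ≤ m)
    (v : Equiv.Perm ℕ) (hv : ∀ i < m, v i = i) (hvd : v (n - d) = m) :
    ∃ v' : Equiv.Perm ℕ, (∀ i < m, v' i = i) ∧
      (nilRow (revStep n) d).coeff d (permSingle v) = permSingle v' := by
  induction d generalizing v with
  | zero => exact ⟨v, hv, by simp [nilRow]⟩
  | succ d ih =>
    set j := n - 1 - d with hj
    have hj1 : n - d = j + 1 := by omega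
    have hj2 : n - (d + 1) = j := by omega
    rw [hj2] at hvd
    rw [coeff_nilRow_succ, Module.End.mul_apply, revStep, if_pos (by omega), ← hj,
      stepOp_single]
    · refine ih (by omega) _ (fun i hi => ?_) ?_
      · rw [Equiv.Perm.mul_apply, sT_of_ne (by omega) (by omega), hv i hi]
      · rw [hj1, Equiv.Perm.mul_apply, sT_right, hvd]
    · rw [hvd]
      by_contra hcon
      rcases lt_or_eq_of_le (not_lt.1 hcon) with h | h
      · have := v.injective (hv _ h)
        omega
      · have := v.injective (h.trans hvd.symm)
        omega

lemma exists_coeff_nilStair_single (n d : ℕ) (hd : d ≤ n - 1) :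
    ∃ v : Equiv.Perm ℕ, (∀ i < n - d, v i = i) ∧
      (nilStair (revStep n) d).coeff (∑ i ∈ Finset.range (d + 1), i) (permSingle 1) =
        permSingle v := by
  induction d with
  | zero => exact ⟨1, fun _ _ => rfl, by simp [nilStair]⟩
  | succ d ih =>
    obtain ⟨v, hv, hc⟩ := ih (by omega)
    obtain ⟨v', hv', hc'⟩ := exists_coeff_nilRow_single n (n - (d + 1)) (d + 1) (by omega)
      (by omega) v (fun i hi => hv i (by omega)) (hv _ (by omega))
    exact ⟨v', hv', by rw [coeff_nilStair_succ, Module.End.mul_apply, hc, hc']⟩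

lemma exists_wordSum_eq_factorial (n : ℕ) :
    ∃ w, len n w = ∑ i ∈ Finset.range n, i ∧
      wordSum n (∑ i ∈ Finset.range n, i) w = (∑ i ∈ Finset.range n, i).factorial := by
  obtain ⟨w, -, hc⟩ := exists_coeff_nilStair_single n (n - 1) le_rfl
  rw [sum_range_pred_succ] at hc
  have h := factorial_mul_coeff_nilStair n (∑ i ∈ Finset.range n, i) w
  rw [hc, permSingle_self, mul_one] at h
  by_cases hl : len n w = ∑ i ∈ Finset.range n, i
  · rw [if_pos hl] at h
    exact ⟨w, hl, h.symm⟩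
  · rw [if_neg hl] at h
    exact absurd h (by positivity)

lemma symmOn_mul {n : ℕ} {v w : Equiv.Perm ℕ} (hv : v ∈ SymmOn n) (hw : w ∈ SymmOn n) :
    v * w ∈ SymmOn n := fun i hi => by
  rw [Equiv.Perm.mul_apply, hw i hi, hv i hi]

lemma symmOn_inv {n : ℕ} {v : Equiv.Perm ℕ} (hv : v ∈ SymmOn n) : v⁻¹ ∈ SymmOn n :=
  fun i hi => by rw [Equiv.Perm.inv_eq_iff_eq, hv i hi]

lemma sT_mem_symmOn {n i : ℕ} (h : i ≠ 0) (hn : i < n) : sT i ∈ SymmOn n :=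
  fun j hj => sT_of_ne (by omega) (by omega)

lemma mapsTo_Icc_of_mem_symmOn {n : ℕ} {w : Equiv.Perm ℕ} (hw : w ∈ SymmOn n) {i : ℕ}
    (hi : 1 ≤ i ∧ i ≤ n) : 1 ≤ w i ∧ w i ≤ n := by
  by_contra h
  have := w.injective (hw (w i) (by omega))
  omega

/-- The symmetric group on `{1, …, n}` is equivalent to the permutations in `SymmOn n`. -/
def permIccEquivSymmOn (n : ℕ) : Equiv.Perm {i // i ∈ Finset.Icc 1 n} ≃ SymmOn n :=
  (Equiv.Perm.subtypeEquivSubtypePerm (fun i => i ∈ Finset.Icc 1 n)).trans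
    (Equiv.subtypeEquivRight fun w => by
      refine forall_congr' fun i => ?_
      rw [Finset.mem_Icc, show ¬(1 ≤ i ∧ i ≤ n) ↔ (i = 0 ∨ n < i) by omega])

lemma symmOn_finite (n : ℕ) : (SymmOn n).Finite :=
  Set.finite_coe_iff.1 (Finite.of_equiv _ (permIccEquivSymmOn n))

lemma card_symmOn (n : ℕ) : (symmOn_finite n).toFinset.card = n.factorial := by
  rw [← Set.ncard_eq_toFinset_card (SymmOn n) (symmOn_finite n), ← Nat.card_coe_set_eq,
    ← Nat.card_congr (permIccEquivSymmOn n), Nat.card_eq_fintype_card, Fintype.card_perm]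
  simp

lemma len_mul_le {n : ℕ} (v : Equiv.Perm ℕ) {w : Equiv.Perm ℕ} (hw : w ∈ SymmOn n) :
    len n (v * w) ≤ len n v + len n w := by
  classical
  rw [len, len, len, ← Finset.card_map (s := Finset.filter (fun p : ℕ × ℕ => p.1 < p.2 ∧
    v p.2 < v p.1) _) (w.prodCongr w).symm.toEmbedding]
  refine (Finset.card_le_card fun p hp => ?_).trans (Finset.card_union_le _ _)
  obtain ⟨a, b⟩ := p
  rw [Finset.mem_filter] at hp
  rw [Finset.mem_union, Finset.mem_filter, Finset.mem_map_equiv, Finset.mem_filter]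
  simp only [Finset.mem_product, Finset.mem_Icc, Equiv.Perm.mul_apply, Equiv.symm_symm,
    Equiv.prodCongr_apply, Prod.map_apply] at hp ⊢
  obtain ⟨⟨ha, hb⟩, hab, hlt⟩ := hp
  rcases lt_or_gt_of_ne (fun e => hab.ne (w.injective e) : w a ≠ w b) with h | h
  · exact Or.inl ⟨⟨mapsTo_Icc_of_mem_symmOn hw ha, mapsTo_Icc_of_mem_symmOn hw hb⟩, h, hlt⟩
  · exact Or.inr ⟨⟨ha, hb⟩, hab, h⟩

lemma wordSum_add (n j k : ℕ) {w : Equiv.Perm ℕ} (hw : w ∈ SymmOn n) :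
    wordSum n (j + k) w =
      ∑ v ∈ (symmOn_finite n).toFinset, wordSum n j v * wordSum n k (v⁻¹ * w) := by
  induction k generalizing w with
  | zero =>
    rw [Finset.sum_eq_single w]
    · simp [wordSum, permSingle_self]
    · intro v _ hv
      have : v⁻¹ * w ≠ 1 := fun h => hv (by rw [inv_mul_eq_one] at h; exact h)
      simp [wordSum, permSingle_of_ne this]
    · intro h
      exact absurd ((symmOn_finite n).mem_toFinset.2 hw) h
  | succ k ih =>
    simp only [← add_assoc, wordSum_succ, Finset.mul_sum]
    rw [Finset.sum_comm]
    refine Finset.sum_congr rfl fun i hi => ?_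
    rcases eq_or_ne i 0 with rfl | h0
    · simp
    · rw [ih (symmOn_mul hw (sT_mem_symmOn h0 (Finset.mem_range.1 hi))), Finset.mul_sum]
      refine Finset.sum_congr rfl fun v _ => ?_
      rw [mul_assoc v⁻¹]
      ring

lemma wordSum_len (n : ℕ) (w : Equiv.Perm ℕ) :
    wordSum n (len n w) w = (len n w).factorial * Upsilon n w := by
  rw [Upsilon_eq, mul_inv_cancel_left₀ (by positivity)]

lemma Upsilon_nonneg (n : ℕ) (w : Equiv.Perm ℕ) : 0 ≤ Upsilon n w := by
  rw [Upsilon_eq]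
  exact mul_nonneg (by positivity) (wordSum_nonneg _ _ _)

lemma bddAbove_Upsilon (n : ℕ) :
    BddAbove ((fun w => ((Upsilon n w : ℚ) : ℝ)) '' SymmOn n) :=
  ((symmOn_finite n).image _).bddAbove

lemma Upsilon_le_u {n : ℕ} {w : Equiv.Perm ℕ} (hw : w ∈ SymmOn n) :
    ((Upsilon n w : ℚ) : ℝ) ≤ u n :=
  le_csSup (bddAbove_Upsilon n) (Set.mem_image_of_mem _ hw)

lemma one_mem_symmOn (n : ℕ) : 1 ∈ SymmOn n := fun _ _ => rfl

lemma u_nonneg (n : ℕ) : 0 ≤ u n :=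
  (Rat.cast_nonneg.2 (Upsilon_nonneg n 1)).trans (Upsilon_le_u (one_mem_symmOn n))

lemma u_le (n : ℕ) : u n ≤ 2 ^ (∑ i ∈ Finset.range n, i) := by
  refine csSup_le (Set.Nonempty.image _ ⟨1, one_mem_symmOn n⟩) ?_
  rintro _ ⟨w, -, rfl⟩
  have := Upsilon_le n w
  beta_reduce
  exact_mod_cast this

lemma choose_mul_wordSum_le {n N k : ℕ} (hk : k ≤ N) {v w : Equiv.Perm ℕ} (hw : len n w = N)
    (hwS : w ∈ SymmOn n) (hv : v ∈ SymmOn n) :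
    (((N.choose k : ℚ) * (wordSum n k v * wordSum n (N - k) (v⁻¹ * w)) : ℚ) : ℝ) ≤
      N.factorial * u n ^ 2 := by
  set x := v⁻¹ * w with hx
  have hxS : x ∈ SymmOn n := symmOn_mul (symmOn_inv hv) hwS
  by_cases h : wordSum n k v * wordSum n (N - k) x = 0
  · rw [h]
    simp only [mul_zero, Rat.cast_zero]
    positivity
  · have h1 := (len_le_of_wordSum_ne_zero (left_ne_zero_of_mul h)).1
    have h2 := (len_le_of_wordSum_ne_zero (right_ne_zero_of_mul h)).1
    have h3 := len_mul_le v hxS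
    rw [hx, mul_inv_cancel_left, ← hx] at h3
    obtain rfl : len n v = k := by omega
    have h4 : N - len n v = len n x := by omega
    have hfac := Nat.choose_mul_factorial_mul_factorial hk
    rw [h4] at hfac ⊢
    rw [wordSum_len, wordSum_len, ← hfac, sq]
    push_cast
    calc _ = ((N.choose (len n v) : ℝ) * (len n v).factorial * (len n x).factorial) *
          ((Upsilon n v : ℝ) * Upsilon n x) := by ring
      _ ≤ _ := by
        refine mul_le_mul_of_nonneg_left ?_ (by positivity)
        exact mul_le_mul (Upsilon_le_u hv) (Upsilon_le_u hxS)
          (Rat.cast_nonneg.2 (Upsilon_nonneg _ _)) (u_nonneg n)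

lemma two_pow_le (n : ℕ) :
    (2 : ℝ) ^ (∑ i ∈ Finset.range n, i) ≤
      ((∑ i ∈ Finset.range n, i : ℕ) + 1) * n.factorial * u n ^ 2 := by
  obtain ⟨w, hl, hw⟩ := exists_wordSum_eq_factorial n
  set N := ∑ i ∈ Finset.range n, i
  have hwS : w ∈ SymmOn n :=
    (len_le_of_wordSum_ne_zero (k := N) (by rw [hw]; positivity)).2
  have key : (2 : ℚ) ^ N * N.factorial = ∑ k ∈ Finset.range (N + 1),
      ∑ v ∈ (symmOn_finite n).toFinset,
        (N.choose k : ℚ) * (wordSum n k v * wordSum n (N - k) (v⁻¹ * w)) := by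
    have h2 : (2 : ℚ) ^ N = ∑ k ∈ Finset.range (N + 1), (N.choose k : ℚ) := by
      exact_mod_cast (Nat.sum_range_choose N).symm
    rw [h2, Finset.sum_mul]
    refine Finset.sum_congr rfl fun k hk => ?_
    rw [← Finset.mul_sum, ← wordSum_add n _ _ hwS,
      Nat.add_sub_cancel' (Nat.lt_succ_iff.1 (Finset.mem_range.1 hk)), hw]
  have key' : (2 : ℝ) ^ N * N.factorial ≤ ∑ k ∈ Finset.range (N + 1),
      ∑ v ∈ (symmOn_finite n).toFinset, N.factorial * u n ^ 2 := by
    have := congrArg (fun q : ℚ => (q : ℝ)) key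
    simp only [Rat.cast_sum] at this
    push_cast at this
    rw [this]
    refine Finset.sum_le_sum fun k hk => Finset.sum_le_sum fun v hv => ?_
    have := choose_mul_wordSum_le (Nat.lt_succ_iff.1 (Finset.mem_range.1 hk)) hl hwS
      ((symmOn_finite n).mem_toFinset.1 hv)
    exact_mod_cast this
  simp only [Finset.sum_const, Finset.card_range, card_symmOn, nsmul_eq_mul] at key'
  have hN : (0 : ℝ) < N.factorial := by positivity
  refine le_of_mul_le_mul_right (key'.trans_eq ?_) hN
  push_cast
  ring

lemma u_pos (n : ℕ) : 0 < u n := by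
  refine (u_nonneg n).lt_of_ne fun h => ?_
  have := two_pow_le n
  rw [← h] at this
  exact absurd this (by simp)

lemma cast_sum_range_id (n : ℕ) :
    ((∑ i ∈ Finset.range n, i : ℕ) : ℝ) = n * (n - 1) / 2 := by
  rw [Nat.cast_sum, eq_div_iff two_ne_zero]
  induction n with
  | zero => simp
  | succ n ih => rw [Finset.sum_range_succ, add_mul, ih]; push_cast; ring

open Real in
lemma logb_u_le (n : ℕ) : logb 2 (u n) ≤ n * (n - 1) / 2 := by
  rw [← cast_sum_range_id, logb_le_iff_le_rpow one_lt_two (u_pos n), rpow_natCast]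
  exact u_le n

open Real in
lemma le_logb_u {n : ℕ} (hn : 2 ≤ n) :
    (n * (n - 1) / 2 - (n + 2) * logb 2 n) / 2 ≤ logb 2 (u n) := by
  have hn' : (2 : ℝ) ≤ n := by exact_mod_cast hn
  have h1 : ((∑ i ∈ Finset.range n, i : ℕ) : ℝ) + 1 ≤ (n : ℝ) ^ 2 := by
    rw [cast_sum_range_id]
    nlinarith
  have h2 : (n.factorial : ℝ) ≤ (n : ℝ) ^ n := by exact_mod_cast Nat.factorial_le_pow n
  have h3 : (2 : ℝ) ^ (∑ i ∈ Finset.range n, i) ≤ (n : ℝ) ^ (n + 2) * u n ^ 2 := by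
    refine (two_pow_le n).trans (mul_le_mul_of_nonneg_right ?_ (sq_nonneg _))
    rw [add_comm n 2, pow_add]
    gcongr
  have h4 := logb_le_logb_of_le one_lt_two (by positivity) h3
  rw [logb_mul (by positivity) (pow_pos (u_pos n) 2).ne', logb_pow, logb_pow, logb_pow,
    logb_self_eq_one one_lt_two, cast_sum_range_id] at h4
  push_cast at h4
  linarith

open Filter Topology in
lemma tendsto_logb_div :
    Tendsto (fun n : ℕ => Real.logb 2 n / n) atTop (𝓝 0) := by
  have h := (Real.isLittleO_log_id_atTop.tendsto_div_nhds_zero.comp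
    tendsto_natCast_atTop_atTop).div_const (Real.log 2)
  rw [zero_div] at h
  refine h.congr fun n => ?_
  simp only [Function.comp, id, Real.logb]
  ring

open Filter Topology in
lemma tendsto_upper :
    Tendsto (fun n : ℕ => ((n : ℝ) * (n - 1) / 2) / (n : ℝ) ^ 2) atTop (𝓝 (1 / 2)) := by
  have h : Tendsto (fun n : ℕ => (1 - (n : ℝ)⁻¹) / 2) atTop (𝓝 ((1 - 0) / 2)) :=
    (tendsto_const_nhds.sub tendsto_inv_atTop_nhds_zero_nat).div_const 2
  rw [sub_zero] at h
  refine h.congr' ((eventually_gt_atTop 0).mono fun n hn => ?_)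
  have : (n : ℝ) ≠ 0 := by positivity
  field_simp

open Filter Topology in
lemma tendsto_lower :
    Tendsto (fun n : ℕ => ((n : ℝ) * (n - 1) / 2 - (n + 2) * Real.logb 2 n) / 2 / (n : ℝ) ^ 2)
      atTop (𝓝 (1 / 4)) := by
  have h : Tendsto (fun n : ℕ => (((n : ℝ) * (n - 1) / 2) / (n : ℝ) ^ 2 -
      (1 + 2 * (n : ℝ)⁻¹) * (Real.logb 2 n / n)) / 2) atTop
      (𝓝 ((1 / 2 - (1 + 2 * 0) * 0) / 2)) :=
    (tendsto_upper.sub ((tendsto_const_nhds.add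
      (tendsto_inv_atTop_nhds_zero_nat.const_mul 2)).mul tendsto_logb_div)).div_const 2
  rw [mul_zero, sub_zero, div_div, show (2 : ℝ) * 2 = 4 by norm_num] at h
  refine h.congr' ((eventually_gt_atTop 0).mono fun n hn => ?_)
  have : (n : ℝ) ≠ 0 := by positivity
  field_simp

/-- Stanley's bounds: `1/4 ≤ liminf (log₂ u(n))/n²` and `limsup (log₂ u(n))/n² ≤ 1/2`. -/
theorem stanley_bounds :
    (1 / 4 : ℝ) ≤ Filter.liminf (fun n : ℕ => Real.logb 2 (u n) / (n : ℝ) ^ 2)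
        Filter.atTop ∧
      Filter.limsup (fun n : ℕ => Real.logb 2 (u n) / (n : ℝ) ^ 2) Filter.atTop
        ≤ (1 / 2 : ℝ) := by
  have hle : ∀ᶠ n : ℕ in Filter.atTop, Real.logb 2 (u n) / (n : ℝ) ^ 2 ≤
      ((n : ℝ) * (n - 1) / 2) / (n : ℝ) ^ 2 :=
    Filter.Eventually.of_forall fun n => div_le_div_of_nonneg_right (logb_u_le n) (sq_nonneg _)
  have hge : ∀ᶠ n : ℕ in Filter.atTop,
      ((n : ℝ) * (n - 1) / 2 - (n + 2) * Real.logb 2 n) / 2 / (n : ℝ) ^ 2 ≤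
        Real.logb 2 (u n) / (n : ℝ) ^ 2 :=
    (Filter.eventually_ge_atTop 2).mono fun n hn =>
      div_le_div_of_nonneg_right (le_logb_u hn) (sq_nonneg _)
  have hbdd : Filter.IsBoundedUnder (· ≤ ·) Filter.atTop
      (fun n : ℕ => Real.logb 2 (u n) / (n : ℝ) ^ 2) :=
    tendsto_upper.isBoundedUnder_le.mono_le hle
  have hbdd' : Filter.IsBoundedUnder (· ≥ ·) Filter.atTop
      (fun n : ℕ => Real.logb 2 (u n) / (n : ℝ) ^ 2) :=
    tendsto_lower.isBoundedUnder_ge.mono_ge hge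
  constructor
  · rw [← tendsto_lower.liminf_eq]
    exact Filter.liminf_le_liminf hge tendsto_lower.isBoundedUnder_ge
      hbdd.isCoboundedUnder_ge
  · rw [← tendsto_upper.limsup_eq]
    exact Filter.limsup_le_limsup hle hbdd'.isCoboundedUnder_le
      tendsto_upper.isBoundedUnder_le
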